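/- Let α > 0 and let r ∈ ℝ^d be a unit vector. Define M = E[exp(-⟨r,z⟩²/α) z zᵀ] where z ~ N(0, I_d). Then every unit vector u orthogonal to r is an eigenvector of M with eigenvalue (α/(α+2))^{1/2}. -/

import Mathlib

open MeasureTheory ProbabilityTheory Matrix

/-- The characteristic function of the standard Gaussian on `n → ℝ`. -/
lemma integral_cexp_dotProduct_pi_gaussianReal {n : Type*} [Fintype n] (t : n → ℝ) :
    ∫ z : n → ℝ, Complex.exp ((z ⬝ᵥ t : ℝ) * Complex.I) ∂(Measure.pi fun _ => gaussianReal 0 1) =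
      Complex.exp (-((t ⬝ᵥ t : ℝ) : ℂ) / 2) := by
  have hmeas : Measurable fun z : EuclideanSpace ℝ n =>
      Complex.exp ((inner ℝ z (WithLp.toLp 2 t) : ℝ) * Complex.I) := by fun_prop
  have h := charFun_stdGaussian (E := EuclideanSpace ℝ n) (WithLp.toLp 2 t)
  rw [← map_pi_eq_stdGaussian, charFun_apply,
    integral_map (by fun_prop) hmeas.aestronglyMeasurable, ← Complex.ofReal_pow,
    EuclideanSpace.real_norm_sq_eq] at h
  simpa [EuclideanSpace.inner_toLp_toLp, dotProduct, mul_comm, pow_two] using h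

/-- A matrix with orthonormal rows pushes the standard Gaussian forward to the standard
Gaussian. -/
lemma measurePreserving_mulVec_pi_gaussianReal {m n : Type*} [Fintype m] [Fintype n]
    [DecidableEq m] (A : Matrix m n ℝ) (hA : A * Aᵀ = 1) :
    MeasurePreserving (fun z : n → ℝ => A *ᵥ z) (Measure.pi fun _ => gaussianReal 0 1)
      (Measure.pi fun _ => gaussianReal 0 1) := by
  have hmeas : Measurable fun z : n → ℝ => A *ᵥ z :=
    (Continuous.matrix_mulVec continuous_const continuous_id).measurable
  refine ⟨hmeas, (MeasurableEquiv.toLp 2 (m → ℝ)).map_measurableEquiv_injective ?_⟩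
  have := Measure.isProbabilityMeasure_map (μ := Measure.pi fun _ : n => gaussianReal 0 1)
    hmeas.aemeasurable
  refine Measure.ext_of_charFun (E := EuclideanSpace ℝ m) (funext fun t => ?_)
  have hexp : Measurable fun z : EuclideanSpace ℝ m =>
      Complex.exp ((inner ℝ z t : ℝ) * Complex.I) := by fun_prop
  have hexp' : Measurable fun z : m → ℝ =>
      Complex.exp ((inner ℝ (MeasurableEquiv.toLp 2 (m → ℝ) z) t : ℝ) * Complex.I) :=
    hexp.comp (MeasurableEquiv.measurable _)
  have hinner : ∀ z : m → ℝ, inner ℝ (MeasurableEquiv.toLp 2 (m → ℝ) z) t = z ⬝ᵥ t.ofLp :=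
    fun z => by simp [PiLp.inner_apply, dotProduct, mul_comm]
  have hadj : ∀ z : n → ℝ, A *ᵥ z ⬝ᵥ t.ofLp = z ⬝ᵥ (t.ofLp ᵥ* A) := fun z => by
    rw [dotProduct_comm, dotProduct_mulVec, dotProduct_comm]
  have hnorm : (t.ofLp ᵥ* A) ⬝ᵥ (t.ofLp ᵥ* A) = t.ofLp ⬝ᵥ t.ofLp := by
    rw [← hadj, ← mulVec_transpose, mulVec_mulVec, hA, one_mulVec]
  rw [charFun_apply, charFun_apply,
    integral_map (MeasurableEquiv.measurable _).aemeasurable hexp.aestronglyMeasurable,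
    integral_map (MeasurableEquiv.measurable _).aemeasurable hexp.aestronglyMeasurable,
    integral_map hmeas.aemeasurable hexp'.aestronglyMeasurable]
  simp_rw [hinner, hadj]
  rw [integral_cexp_dotProduct_pi_gaussianReal, integral_cexp_dotProduct_pi_gaussianReal, hnorm]

lemma integral_exp_neg_sq_div_gaussianReal {α : ℝ} (hα : 0 < α) :
    ∫ x, Real.exp (-x ^ 2 / α) ∂(gaussianReal 0 1) = (α / (α + 2)) ^ ((1 : ℝ) / 2) := by
  rw [integral_gaussianReal_eq_integral_smul one_ne_zero]
  have h : ∀ x : ℝ, gaussianPDFReal 0 1 x • Real.exp (-x ^ 2 / α) =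
      (√(2 * Real.pi))⁻¹ * Real.exp (-((α + 2) / (2 * α)) * x ^ 2) := fun x => by
    rw [gaussianPDFReal, smul_eq_mul, mul_assoc, ← Real.exp_add]
    congr 2
    · simp
    · simp
      field_simp
      ring
  simp_rw [h]
  rw [integral_const_mul, integral_gaussian, ← Real.sqrt_eq_rpow, ← Real.sqrt_inv,
    ← Real.sqrt_mul (by positivity)]
  congr 1
  field_simp

lemma integral_sq_gaussianReal : ∫ x, x ^ 2 ∂(gaussianReal 0 1) = 1 := by
  have h := variance_fun_id_gaussianReal (μ := 0) (v := 1)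
  rw [variance_eq_integral measurable_id'.aemeasurable] at h
  simpa using h

/-- Orthogonal linear functionals of a standard Gaussian vector are independent, and this
evaluates the weighted second moment. -/
lemma integral_exp_neg_sq_div_mul_sq_pi_gaussianReal {n : Type*} [Fintype n]
    {α : ℝ} (hα : 0 < α) {r u : n → ℝ} (hr : r ⬝ᵥ r = 1) (hu : u ⬝ᵥ u = 1) (hru : r ⬝ᵥ u = 0) :
    ∫ z : n → ℝ, Real.exp (-(r ⬝ᵥ z) ^ 2 / α) * (u ⬝ᵥ z) ^ 2
      ∂(Measure.pi fun _ => gaussianReal 0 1) = (α / (α + 2)) ^ ((1 : ℝ) / 2) := by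
  have hA : Matrix.of ![r, u] * (Matrix.of ![r, u])ᵀ = 1 := by
    ext i j
    fin_cases i <;> fin_cases j <;>
      simpa [mul_apply, dotProduct, mul_comm] using by assumption
  have hmp := measurePreserving_mulVec_pi_gaussianReal _ hA
  have h := integral_map (φ := fun z : n → ℝ => Matrix.of ![r, u] *ᵥ z)
    (μ := Measure.pi fun _ => gaussianReal 0 1) hmp.aemeasurable
    (f := fun x : Fin 2 → ℝ => Real.exp (-x 0 ^ 2 / α) * x 1 ^ 2)
    (Measurable.aestronglyMeasurable (by fun_prop))
  rw [hmp.map_eq] at h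
  refine Eq.trans ?_ (h.symm.trans ?_)
  · rfl
  · have h2 := integral_fintype_prod_eq_prod (𝕜 := ℝ) (ι := Fin 2)
      (μ := fun _ => gaussianReal 0 1)
      (f := ![fun x => Real.exp (-x ^ 2 / α), fun x => x ^ 2])
    simp only [Fin.prod_univ_two, cons_val_zero, cons_val_one] at h2
    rw [h2, integral_exp_neg_sq_div_gaussianReal hα, integral_sq_gaussianReal, mul_one]

lemma integrable_exp_neg_sq_div_mul_pi_gaussianReal {n : Type*} [Fintype n]
    {α : ℝ} (hα : 0 < α) (r : n → ℝ) (i j : n) :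
    Integrable (fun z : n → ℝ => Real.exp (-(r ⬝ᵥ z) ^ 2 / α) * (z i * z j))
      (Measure.pi fun _ => gaussianReal 0 1) := by
  have hmem : ∀ k : n, MemLp (fun z : n → ℝ => z k) 2 (Measure.pi fun _ => gaussianReal 0 1) :=
    fun k => (memLp_id_gaussianReal' 2 (by simp)).comp_measurePreserving
      (measurePreserving_eval (fun _ : n => gaussianReal 0 1) k)
  refine ((hmem i).integrable_mul (hmem j)).bdd_mul (c := 1)
    (Measurable.aestronglyMeasurable ?_) (.of_forall fun z => ?_)
  · simp only [dotProduct]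
    fun_prop
  · rw [Real.norm_eq_abs, Real.abs_exp, Real.exp_le_one_iff]
    exact div_nonpos_of_nonpos_of_nonneg (by nlinarith [sq_nonneg (r ⬝ᵥ z)]) hα.le

/-- Lemma (FLOW): for a unit vector `r` and `z ~ N(0, I_d)`, every unit vector `u`
orthogonal to `r` is an eigenvector of `M = E[exp(-⟨r,z⟩²/α) z zᵀ]` with eigenvalue
`(α/(α+2))^{1/2}`. -/
theorem stmt_4 (d : ℕ) (α : ℝ) (hα : 0 < α)
    (r : Fin d → ℝ) (hr : r ⬝ᵥ r = 1)
    (M : Matrix (Fin d) (Fin d) ℝ)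
    (hM : ∀ i j, M i j =
      ∫ z : Fin d → ℝ, Real.exp (-(r ⬝ᵥ z) ^ 2 / α) * (z i * z j)
        ∂(Measure.pi fun _ : Fin d => gaussianReal 0 1)) :
    ∀ u : Fin d → ℝ, u ⬝ᵥ u = 1 → r ⬝ᵥ u = 0 →
      M.mulVec u = ((α / (α + 2)) ^ ((1 : ℝ) / 2)) • u := by
  intro u hu hru
  have hint := integrable_exp_neg_sq_div_mul_pi_gaussianReal hα r
  set γ : Measure (Fin d → ℝ) := Measure.pi fun _ : Fin d => gaussianReal 0 1 with hγ
  have hexp : ∀ i, (fun z : Fin d → ℝ => Real.exp (-(r ⬝ᵥ z) ^ 2 / α) * (z i * (u ⬝ᵥ z))) =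
      fun z => ∑ j, Real.exp (-(r ⬝ᵥ z) ^ 2 / α) * (z i * z j) * u j := fun i => by
    ext z
    simp only [dotProduct, Finset.mul_sum]
    exact Finset.sum_congr rfl fun j _ => by ring
  have hintu : ∀ i, Integrable
      (fun z : Fin d → ℝ => Real.exp (-(r ⬝ᵥ z) ^ 2 / α) * (z i * (u ⬝ᵥ z))) γ := fun i => by
    rw [hexp]
    exact integrable_finsetSum _ fun j _ => (hint i j).mul_const _
  have hMu : ∀ i, (M *ᵥ u) i =
      ∫ z, Real.exp (-(r ⬝ᵥ z) ^ 2 / α) * (z i * (u ⬝ᵥ z)) ∂γ := fun i => by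
    rw [hexp, integral_finsetSum _ fun j _ => (hint i j).mul_const _]
    simp only [integral_mul_const, mulVec, dotProduct, hM]
  have hsq : Integrable (fun z : Fin d → ℝ =>
      Real.exp (-(r ⬝ᵥ z) ^ 2 / α) * (u ⬝ᵥ z) ^ 2) γ := by
    have : (fun z : Fin d → ℝ => Real.exp (-(r ⬝ᵥ z) ^ 2 / α) * (u ⬝ᵥ z) ^ 2) =
        fun z => ∑ i, u i * (Real.exp (-(r ⬝ᵥ z) ^ 2 / α) * (z i * (u ⬝ᵥ z))) := by
      ext z
      calc _ = Real.exp (-(r ⬝ᵥ z) ^ 2 / α) * (u ⬝ᵥ z) * ∑ i, u i * z i := by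
            rw [sq (u ⬝ᵥ z), ← mul_assoc]; rfl
        _ = _ := by
            rw [Finset.mul_sum]
            exact Finset.sum_congr rfl fun j _ => by ring
    rw [this]
    exact integrable_finsetSum _ fun i _ => (hintu i).const_mul _
  have hH : (1 - (2 : ℝ) • vecMulVec u u) * (1 - (2 : ℝ) • vecMulVec u u)ᵀ = 1 := by
    have h : vecMulVec u u * vecMulVec u u = vecMulVec u u := by
      rw [vecMulVec_mul_vecMulVec, hu, one_smul]
    have ht : (vecMulVec u u)ᵀ = vecMulVec u u := transpose_vecMulVec u u
    rw [transpose_sub, transpose_smul, ht, transpose_one]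
    simp only [sub_mul, mul_sub, one_mul, mul_one, smul_mul_smul_comm, h]
    module
  have hmp := measurePreserving_mulVec_pi_gaussianReal _ hH
  have hHz : ∀ z : Fin d → ℝ, (1 - (2 : ℝ) • vecMulVec u u) *ᵥ z = z - (2 * (u ⬝ᵥ z)) • u :=
    fun z => by
      rw [sub_mulVec, one_mulVec, smul_mulVec, vecMulVec_mulVec]
      ext i
      simp
      ring
  ext i
  have hrefl : ∫ z, Real.exp (-(r ⬝ᵥ z) ^ 2 / α) * (z i * (u ⬝ᵥ z)) ∂γ =
      ∫ z, (2 * u i * (Real.exp (-(r ⬝ᵥ z) ^ 2 / α) * (u ⬝ᵥ z) ^ 2) -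
        Real.exp (-(r ⬝ᵥ z) ^ 2 / α) * (z i * (u ⬝ᵥ z))) ∂γ := by
    conv_lhs => rw [hγ, ← hmp.map_eq]
    rw [integral_map hmp.aemeasurable (by rw [hmp.map_eq]; exact (hintu i).aestronglyMeasurable)]
    refine integral_congr_ae (.of_forall fun z => ?_)
    simp only [hHz, dotProduct_sub, dotProduct_smul, hu, hru, Pi.sub_apply, Pi.smul_apply,
      smul_eq_mul, mul_zero, sub_zero]
    ring
  rw [integral_sub (hsq.const_mul _) (hintu i), integral_const_mul,
    integral_exp_neg_sq_div_mul_sq_pi_gaussianReal hα hr hu hru] at hrefl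
  rw [hMu, Pi.smul_apply, smul_eq_mul]
  linarith
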